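/- Let H be a complex Hilbert space, let I be a subinterval of (0,∞), and let f : I → (0,∞) be a continuous operator geometrically convex function. Then for all commuting positive invertible bounded operators A, B on H with spectra contained in I: log f(√(AB)) ≤ ∫_0^1 log f(A^t B^(1−t)) dt ≤ (1/2)·(log f(A) + log f(B)) in the operator order, where the integral is the Bochner integral of the operator-valued function t ↦ log f(A^t B^(1−t)) on [0,1]. -/

import Mathlib

open MeasureTheory NormedSpace

section CStarAlgebra

variable {𝒜 : Type*} [CStarAlgebra 𝒜]

theorem isSelfAdjoint_smul_log_add_smul_log (a b : 𝒜) (s t : ℝ) :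
    IsSelfAdjoint (s • CFC.log a + t • CFC.log b) :=
  ((IsSelfAdjoint.all s).smul .log).add ((IsSelfAdjoint.all t).smul .log)

theorem smul_log_add_smul_log_commute {a b : 𝒜} (hab : Commute a b) (s t u v : ℝ) :
    Commute (s • CFC.log a + t • CFC.log b) (u • CFC.log a + v • CFC.log b) := by
  have hcomm : Commute (CFC.log a) (CFC.log b) := ((hab.cfc_real _).symm.cfc_real _).symm
  refine .add_left (.add_right ?_ ?_) (.add_right ?_ ?_)
  · exact ((Commute.refl _).smul_left s).smul_right u
  · exact (hcomm.smul_left s).smul_right v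
  · exact (hcomm.symm.smul_left t).smul_right u
  · exact ((Commute.refl _).smul_left t).smul_right v

variable [PartialOrder 𝒜] [StarOrderedRing 𝒜]

theorem CFC.rpow_eq_exp_smul_log {a : 𝒜} (ha : IsStrictlyPositive a) (t : ℝ) :
    a ^ t = exp (t • CFC.log a) := by
  have h0 : ∀ x ∈ spectrum ℝ a, 0 < x := fun x hx => ha.spectrum_pos hx
  have hlog : ContinuousOn Real.log (spectrum ℝ a) :=
    Real.continuousOn_log.mono fun x hx => (h0 x hx).ne'
  rw [CFC.rpow_eq_cfc_real ha.nonneg, CFC.log, ← cfc_smul t Real.log a hlog,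
    ← CFC.real_exp_eq_normedSpace_exp (cfc_predicate _ a),
    ← cfc_comp' Real.exp (fun x => t • Real.log x) a
      Real.continuous_exp.continuousOn (hlog.const_smul t)]
  refine cfc_congr fun x hx => ?_
  simp [Real.rpow_def_of_pos (h0 x hx), mul_comm]

theorem CFC.rpow_mul_rpow_eq_exp {a b : 𝒜} (ha : IsStrictlyPositive a)
    (hb : IsStrictlyPositive b) (hab : Commute a b) (s t : ℝ) :
    a ^ s * b ^ t = exp (s • CFC.log a + t • CFC.log b) := by
  let : NormedAlgebra ℚ 𝒜 := .restrictScalars ℚ ℂ 𝒜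
  have hcomm : Commute (CFC.log a) (CFC.log b) := ((hab.cfc_real _).symm.cfc_real _).symm
  rw [CFC.rpow_eq_exp_smul_log ha, CFC.rpow_eq_exp_smul_log hb,
    exp_add_of_commute ((hcomm.smul_left s).smul_right t)]

theorem IsSelfAdjoint.isStrictlyPositive_exp {a : 𝒜} (ha : IsSelfAdjoint a) :
    IsStrictlyPositive (NormedSpace.exp a) :=
  let : NormedAlgebra ℚ 𝒜 := .restrictScalars ℚ ℂ 𝒜
  ⟨ha.exp_nonneg, isUnit_exp a⟩

theorem isStrictlyPositive_cfc {f : ℝ → ℝ} {a : 𝒜} (ha : IsSelfAdjoint a)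
    (hf : ContinuousOn f (spectrum ℝ a)) (hpos : ∀ x ∈ spectrum ℝ a, 0 < f x) :
    IsStrictlyPositive (cfc f a) :=
  have hne : ∀ x ∈ spectrum ℝ a, f x ≠ 0 := fun x hx => (hpos x hx).ne'
  ⟨cfc_nonneg fun x hx => (hpos x hx).le, (isUnit_cfc_iff f a).2 hne⟩

/-- The weighted geometric mean of commuting strictly positive elements has its spectrum in
every interval that contains both spectra. -/
theorem spectrum_rpow_mul_rpow_subset_Icc {a b : 𝒜} (ha : IsStrictlyPositive a)
    (hb : IsStrictlyPositive b) (hab : Commute a b) {m M : ℝ} (hm : 0 < m)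
    (hsa : spectrum ℝ a ⊆ Set.Icc m M) (hsb : spectrum ℝ b ⊆ Set.Icc m M)
    {t : ℝ} (ht : t ∈ Set.Icc (0 : ℝ) 1) :
    spectrum ℝ (a ^ t * b ^ (1 - t)) ⊆ Set.Icc m M := by
  have hlog (c : 𝒜) (hc : IsStrictlyPositive c) (hsc : spectrum ℝ c ⊆ Set.Icc m M) :
      algebraMap ℝ 𝒜 (Real.log m) ≤ CFC.log c ∧ CFC.log c ≤ algebraMap ℝ 𝒜 (Real.log M) := by
    have hcont : ContinuousOn Real.log (spectrum ℝ c) :=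
      Real.continuousOn_log.mono fun x hx => (hm.trans_le (hsc hx).1).ne'
    have hcs : IsSelfAdjoint c := .of_nonneg hc.nonneg
    exact ⟨algebraMap_le_cfc _ _ _ fun x hx => Real.log_le_log hm (hsc hx).1,
      cfc_le_algebraMap _ _ _ fun x hx => Real.log_le_log (hm.trans_le (hsc hx).1) (hsc hx).2⟩
  have h1t : 0 ≤ 1 - t := sub_nonneg.2 ht.2
  have hL := isSelfAdjoint_smul_log_add_smul_log a b t (1 - t)
  have hlow : algebraMap ℝ 𝒜 (Real.log m) ≤ t • CFC.log a + (1 - t) • CFC.log b := by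
    calc algebraMap ℝ 𝒜 (Real.log m)
        = t • algebraMap ℝ 𝒜 (Real.log m) + (1 - t) • algebraMap ℝ 𝒜 (Real.log m) := by
          rw [← add_smul]; simp
      _ ≤ _ := add_le_add (smul_le_smul_of_nonneg_left (hlog a ha hsa).1 ht.1)
          (smul_le_smul_of_nonneg_left (hlog b hb hsb).1 h1t)
  have hupp : t • CFC.log a + (1 - t) • CFC.log b ≤ algebraMap ℝ 𝒜 (Real.log M) := by
    calc _ ≤ t • algebraMap ℝ 𝒜 (Real.log M) + (1 - t) • algebraMap ℝ 𝒜 (Real.log M) :=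
          add_le_add (smul_le_smul_of_nonneg_left (hlog a ha hsa).2 ht.1)
            (smul_le_smul_of_nonneg_left (hlog b hb hsb).2 h1t)
      _ = _ := by rw [← add_smul]; simp
  rw [CFC.rpow_mul_rpow_eq_exp ha hb hab, ← CFC.real_exp_eq_normedSpace_exp hL,
    cfc_map_spectrum Real.exp _ hL]
  rintro _ ⟨x, hx, rfl⟩
  have hxm := (algebraMap_le_iff_le_spectrum hL).1 hlow x hx
  have hxM := (le_algebraMap_iff_spectrum_le hL).1 hupp x hx
  have hM : 0 < M := by
    have : Nontrivial 𝒜 := by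
      by_contra h
      have := not_nontrivial_iff_subsingleton.1 h
      simp [spectrum.of_subsingleton] at hx
    obtain ⟨y, hy⟩ := ContinuousFunctionalCalculus.spectrum_nonempty (R := ℝ) a
      (IsSelfAdjoint.of_nonneg ha.nonneg)
    exact hm.trans_le ((hsa hy).1.trans (hsa hy).2)
  exact ⟨(Real.log_le_iff_le_exp hm).1 hxm, (Real.le_log_iff_exp_le hM).1 hxM⟩

theorem sqrt_mul_eq_rpow_mul_rpow_half {a b : 𝒜} (ha : IsStrictlyPositive a)
    (hb : IsStrictlyPositive b) (hab : Commute a b) (t : ℝ) :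
    CFC.sqrt (a * b) = (a ^ t * b ^ (1 - t)) ^ (1 / 2 : ℝ) *
      (a ^ (1 - t) * b ^ (1 - (1 - t))) ^ (1 - 1 / 2 : ℝ) := by
  let : NormedAlgebra ℚ 𝒜 := .restrictScalars ℚ ℂ 𝒜
  set L : 𝒜 := (1 / 2 : ℝ) • CFC.log a + (1 / 2 : ℝ) • CFC.log b with hLdef
  have hL : IsSelfAdjoint L := isSelfAdjoint_smul_log_add_smul_log a b _ _
  have hsa (s : ℝ) := isSelfAdjoint_smul_log_add_smul_log a b s (1 - s)
  have hexp (s : ℝ) : a ^ s * b ^ (1 - s) = exp (s • CFC.log a + (1 - s) • CFC.log b) :=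
    CFC.rpow_mul_rpow_eq_exp ha hb hab _ _
  have hcomm : Commute (exp (t • CFC.log a + (1 - t) • CFC.log b))
      (exp ((1 - t) • CFC.log a + (1 - (1 - t)) • CFC.log b)) :=
    (smul_log_add_smul_log_commute hab _ _ _ _).exp
  have hsqrt : CFC.sqrt (a * b) = exp L := by
    refine CFC.sqrt_unique ?_ hL.exp_nonneg
    rw [← exp_add_of_commute (Commute.refl L)]
    have := CFC.rpow_mul_rpow_eq_exp ha hb hab 1 1
    rw [CFC.rpow_one a ha.nonneg, CFC.rpow_one b hb.nonneg] at this
    rw [this, hLdef]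
    congr 1
    module
  rw [hsqrt, hexp, hexp, CFC.rpow_mul_rpow_eq_exp (hsa t).isStrictlyPositive_exp
    (hsa (1 - t)).isStrictlyPositive_exp hcomm, CFC.log_exp _ (hsa t),
    CFC.log_exp _ (hsa (1 - t)), hLdef]
  congr 1
  module

end CStarAlgebra

/-- If the symmetrization `(F t + F (1 - t)) / 2` lies between `c` and `d`, so does `∫ F`. -/
theorem intervalIntegral_mem_Icc_of_symmetrization {E : Type*} [NormedAddCommGroup E]
    [NormedSpace ℝ E] [CompleteSpace E] [PartialOrder E] [IsOrderedAddMonoid E]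
    [IsOrderedModule ℝ E] [ClosedIciTopology E] {F : ℝ → E}
    (hF : ContinuousOn F (Set.Icc 0 1)) {c d : E}
    (h : ∀ t ∈ Set.Icc (0 : ℝ) 1, (1 / 2 : ℝ) • (F t + F (1 - t)) ∈ Set.Icc c d) :
    ∫ t in (0 : ℝ)..1, F t ∈ Set.Icc c d := by
  have hFi : IntervalIntegrable F volume 0 1 :=
    ContinuousOn.intervalIntegrable (by rwa [Set.uIcc_of_le zero_le_one])
  have hFi' : IntervalIntegrable (fun t => F (1 - t)) volume 0 1 := by
    simpa using (hFi.comp_sub_left 1).symm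
  have hint : IntervalIntegrable (fun t => (1 / 2 : ℝ) • (F t + F (1 - t))) volume 0 1 :=
    (hFi.add hFi').smul (1 / 2 : ℝ)
  have heq : ∫ t in (0 : ℝ)..1, F t = ∫ t in (0 : ℝ)..1, (1 / 2 : ℝ) • (F t + F (1 - t)) := by
    rw [intervalIntegral.integral_smul, intervalIntegral.integral_add hFi hFi',
      intervalIntegral.integral_comp_sub_left F 1]
    simp only [sub_self, sub_zero]
    module
  have hconst (e : E) : ∫ _ in Set.Ioc (0 : ℝ) 1, e = e := by simp
  rw [heq, intervalIntegral.integral_of_le zero_le_one]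
  constructor
  · rw [← hconst c]
    refine integral_mono_ae (integrable_const _) hint.1 ?_
    filter_upwards [ae_restrict_mem measurableSet_Ioc] with t ht
    simpa using (h t (Set.Ioc_subset_Icc_self ht)).1
  · rw [← hconst d]
    refine integral_mono_ae hint.1 (integrable_const _) ?_
    filter_upwards [ae_restrict_mem measurableSet_Ioc] with t ht
    simpa using (h t (Set.Ioc_subset_Icc_self ht)).2

/-- **Hermite–Hadamard type inequality for operator geometrically convex functions**
(logarithmic form). If `f : I → (0,∞)` is continuous and operator geometrically convex,
then for commuting positive invertible `A`, `B` with spectra in `I`: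
`log f(√(AB)) ≤ ∫_0^1 log f(A^t B^(1−t)) dt ≤ (1/2)(log f(A) + log f(B))`. -/
theorem stmt_12 {H : Type*} [NormedAddCommGroup H] [InnerProductSpace ℂ H]
    [CompleteSpace H] (I : Set ℝ) (hI : I ⊆ Set.Ioi (0 : ℝ)) (hI' : I.OrdConnected)
    (f : ℝ → ℝ) (hfpos : ∀ x ∈ I, 0 < f x) (hfcont : ContinuousOn f I)
    (hogc : ∀ (A B : H →L[ℂ] H), 0 ≤ A → 0 ≤ B → IsUnit A → IsUnit B →
      A * B = B * A → spectrum ℝ A ⊆ I → spectrum ℝ B ⊆ I →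
      ∀ l ∈ Set.Icc (0 : ℝ) 1,
        cfc f (A ^ l * B ^ (1 - l)) ≤ (cfc f A) ^ l * (cfc f B) ^ (1 - l))
    (A B : H →L[ℂ] H) (hA : 0 ≤ A) (hB : 0 ≤ B) (hAu : IsUnit A) (hBu : IsUnit B)
    (hAB : A * B = B * A) (hsA : spectrum ℝ A ⊆ I) (hsB : spectrum ℝ B ⊆ I) :
    CFC.log (cfc f (CFC.sqrt (A * B))) ≤
      (∫ t in (0 : ℝ)..1, CFC.log (cfc f (A ^ t * B ^ (1 - t)))) ∧
    (∫ t in (0 : ℝ)..1, CFC.log (cfc f (A ^ t * B ^ (1 - t)))) ≤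
      (1 / 2 : ℝ) • (CFC.log (cfc f A) + CFC.log (cfc f B)) := by
  rcases subsingleton_or_nontrivial (H →L[ℂ] H) with _ | _
  · exact ⟨(Subsingleton.elim _ _).le, (Subsingleton.elim _ _).le⟩
  have hAp : IsStrictlyPositive A := ⟨hA, hAu⟩
  have hBp : IsStrictlyPositive B := ⟨hB, hBu⟩
  have hlogconv {P Q : H →L[ℂ] H} (hP : IsStrictlyPositive P) (hQ : IsStrictlyPositive Q)
      (hPQ : Commute P Q) (hsP : spectrum ℝ P ⊆ I) (hsQ : spectrum ℝ Q ⊆ I) {l : ℝ}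
      (hl : l ∈ Set.Icc (0 : ℝ) 1) (hs : spectrum ℝ (P ^ l * Q ^ (1 - l)) ⊆ I) :
      CFC.log (cfc f (P ^ l * Q ^ (1 - l))) ≤
        l • CFC.log (cfc f P) + (1 - l) • CFC.log (cfc f Q) := by
    have hfp {X : H →L[ℂ] H} (hX : IsSelfAdjoint X) (hsX : spectrum ℝ X ⊆ I) :
        IsStrictlyPositive (cfc f X) :=
      isStrictlyPositive_cfc hX (hfcont.mono hsX) fun x hx => hfpos x (hsX hx)
    have hfPQ : Commute (cfc f P) (cfc f Q) := ((hPQ.cfc_real f).symm.cfc_real f).symm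
    have hsa : IsSelfAdjoint (P ^ l * Q ^ (1 - l)) := by
      rw [CFC.rpow_mul_rpow_eq_exp hP hQ hPQ]
      exact .of_nonneg (isSelfAdjoint_smul_log_add_smul_log P Q l (1 - l)).exp_nonneg
    calc _ ≤ CFC.log ((cfc f P) ^ l * (cfc f Q) ^ (1 - l)) :=
          CFC.log_le_log (hogc P Q hP.nonneg hQ.nonneg hP.isUnit hQ.isUnit hPQ hsP hsQ l hl)
            (hfp hsa hs)
      _ = _ := by
          rw [CFC.rpow_mul_rpow_eq_exp (hfp (.of_nonneg hP.nonneg) hsP)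
            (hfp (.of_nonneg hQ.nonneg) hsQ) hfPQ,
            CFC.log_exp _ (isSelfAdjoint_smul_log_add_smul_log _ _ _ _)]
  obtain ⟨m, M, hmI, hmM, hAm, hBm⟩ : ∃ m M, 0 < m ∧ Set.Icc m M ⊆ I ∧
      spectrum ℝ A ⊆ Set.Icc m M ∧ spectrum ℝ B ⊆ Set.Icc m M := by
    have hK : IsCompact (spectrum ℝ A ∪ spectrum ℝ B) :=
      (ContinuousFunctionalCalculus.isCompact_spectrum A).union
        (ContinuousFunctionalCalculus.isCompact_spectrum B)
    have hne : (spectrum ℝ A ∪ spectrum ℝ B).Nonempty :=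
      (ContinuousFunctionalCalculus.spectrum_nonempty (R := ℝ) A (.of_nonneg hA)).inl
    have hKI : spectrum ℝ A ∪ spectrum ℝ B ⊆ I := Set.union_subset hsA hsB
    obtain ⟨m, hm, hmin⟩ := hK.exists_isLeast hne
    obtain ⟨M, hM, hmax⟩ := hK.exists_isGreatest hne
    exact ⟨m, M, hI (hKI hm), hI'.out (hKI hm) (hKI hM),
      fun x hx => ⟨hmin (.inl hx), hmax (.inl hx)⟩, fun x hx => ⟨hmin (.inr hx), hmax (.inr hx)⟩⟩
  have hG (t : ℝ) := CFC.rpow_mul_rpow_eq_exp hAp hBp hAB t (1 - t)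
  have hGp (t : ℝ) : IsStrictlyPositive (A ^ t * B ^ (1 - t)) :=
    hG t ▸ (isSelfAdjoint_smul_log_add_smul_log A B t (1 - t)).isStrictlyPositive_exp
  have hGs {t : ℝ} (ht : t ∈ Set.Icc (0 : ℝ) 1) :
      spectrum ℝ (A ^ t * B ^ (1 - t)) ⊆ Set.Icc m M :=
    spectrum_rpow_mul_rpow_subset_Icc hAp hBp hAB hmI hAm hBm ht
  have hGcomm (s t : ℝ) : Commute (A ^ s * B ^ (1 - s)) (A ^ t * B ^ (1 - t)) := by
    rw [hG, hG]
    let : NormedAlgebra ℚ (H →L[ℂ] H) := .restrictScalars ℚ ℂ _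
    exact (smul_log_add_smul_log_commute hAB _ _ _ _).exp
  have hGcont : Continuous fun t : ℝ => A ^ t * B ^ (1 - t) := by
    simp_rw [hG]
    let : NormedAlgebra ℚ (H →L[ℂ] H) := .restrictScalars ℚ ℂ _
    exact exp_continuous.comp (by fun_prop)
  have hfc : ContinuousOn f (Set.Icc m M) := hfcont.mono hmM
  have hFcont : ContinuousOn (fun t : ℝ => CFC.log (cfc f (A ^ t * B ^ (1 - t))))
      (Set.Icc 0 1) := by
    refine CFC.continuousOn_log.comp (hGcont.continuousOn.cfc' isCompact_Icc f (fun t ht => hGs ht)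
      (fun t _ => .of_nonneg (hGp t).nonneg) hfc) fun t ht => ⟨cfc_predicate _ _, ?_⟩
    exact (isStrictlyPositive_cfc (.of_nonneg (hGp t).nonneg) (hfc.mono (hGs ht))
      fun x hx => hfpos x (hmM (hGs ht hx))).isUnit
  refine Set.mem_Icc.1 (intervalIntegral_mem_Icc_of_symmetrization hFcont fun t ht => ?_)
  have ht' : 1 - t ∈ Set.Icc (0 : ℝ) 1 := ⟨sub_nonneg.2 ht.2, sub_le_self _ ht.1⟩
  have hhalf : (1 / 2 : ℝ) ∈ Set.Icc (0 : ℝ) 1 := by norm_num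
  constructor
  · rw [sqrt_mul_eq_rpow_mul_rpow_half hAp hBp hAB t]
    refine (hlogconv (hGp t) (hGp (1 - t)) (hGcomm _ _) ((hGs ht).trans hmM)
      ((hGs ht').trans hmM) hhalf ((spectrum_rpow_mul_rpow_subset_Icc (hGp t) (hGp (1 - t))
        (hGcomm _ _) hmI (hGs ht) (hGs ht') hhalf).trans hmM)).trans_eq ?_
    module
  · refine smul_le_smul_of_nonneg_left ?_ (by norm_num)
    refine (add_le_add (hlogconv hAp hBp hAB hsA hsB ht ((hGs ht).trans hmM))
      (hlogconv hAp hBp hAB hsA hsB ht' ((hGs ht').trans hmM))).trans_eq ?_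
    module
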